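/- For every j ∈ {2,3,4} and λ ∈ {1,-1}, there do not exist nowhere-vanishing smooth functions m, n : ℝ³ → ℝ and a nonzero constant vector C ∈ ℝ⁴ such that L₂N(s,t,w) = m(s,t,w)·N(s,t,w) + n(s,t,w)·C for all (s,t,w) ∈ ℝ³. In other words, no tubular hypersurface obtained by pseudo hyperspheres or pseudo hyperbolic hyperspheres whose centers lie on a spacelike curve with non-null Frenet vector fields in E⁴₁ has generalized L₂ 1-type Gauss map. -/

import Mathlib

noncomputable section

open Real

set_option linter.unusedVariables false

/-- Minkowski inner product on `ℝ⁴` with signature `(-,+,+,+)`. -/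
def mink (u v : Fin 4 → ℝ) : ℝ :=
  -(u 0 * v 0) + u 1 * v 1 + u 2 * v 2 + u 3 * v 3

/-- `εᵢ = ⟨Fᵢ,Fᵢ⟩` : equals `-1` if `i = j` and `1` otherwise. -/
def eps (j i : ℕ) : ℝ := if i = j then -1 else 1

/-- `σ = 1` if `j = 2` and `σ = -1` if `j ∈ {3,4}`. -/
def sigma' (j : ℕ) : ℝ := if j = 2 then 1 else -1

/-- `τ = 1` if `j ∈ {2,3}` and `τ = -1` if `j = 4`. -/
def tau' (j : ℕ) : ℝ := if j = 4 then -1 else 1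

/-- The functions `μ₂, μ₃, μ₄` defined by the cyclic index rule
(`μ₅ := μ₂`, `μ₆ := μ₃`): `μⱼ = cosh t·sinh w`, `μⱼ₊₁ = cosh w`,
`μⱼ₊₂ = sinh t·sinh w` if `λ = 1`, and `μⱼ = cosh t·cosh w`,
`μⱼ₊₁ = sinh w`, `μⱼ₊₂ = sinh t·cosh w` if `λ = -1`. -/
def mu (j : ℕ) (lam : ℝ) (i : ℕ) (t w : ℝ) : ℝ :=
  if (i + 3 - j) % 3 = 0 then cosh t * (if lam = 1 then sinh w else cosh w)
  else if (i + 3 - j) % 3 = 1 then (if lam = 1 then cosh w else sinh w)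
  else sinh t * (if lam = 1 then sinh w else cosh w)

/-- Gauss map of the tubular hypersurface `T^{j,λ}` about a spacelike curve of type `j`. -/
def gaussNJ (j : ℕ) (lam : ℝ) (F₂ F₃ F₄ : ℝ → Fin 4 → ℝ) (s t w : ℝ) : Fin 4 → ℝ :=
  (-(sigma' j) * lam ^ j) •
    (mu j lam 2 t w • F₂ s + mu j lam 3 t w • F₃ s + mu j lam 4 t w • F₄ s)

/-- The tubular hypersurface `T^{j,λ}` about a spacelike curve of type `j`. -/
def tubeTJ (j : ℕ) (lam r : ℝ) (β F₂ F₃ F₄ : ℝ → Fin 4 → ℝ) (s t w : ℝ) : Fin 4 → ℝ :=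
  β s + r • (mu j lam 2 t w • F₂ s + mu j lam 3 t w • F₃ s + mu j lam 4 t w • F₄ s)

/-- The function `D(s,t,w) = σ + r k₁(s) μ₂(t,w)`. -/
def DJ (j : ℕ) (lam r : ℝ) (k₁ : ℝ → ℝ) (s t w : ℝ) : ℝ :=
  sigma' j + r * k₁ s * mu j lam 2 t w

/-- The Cheng–Yau operator `ℒ₁` applied to the Gauss map of `T^{j,λ}`. -/
def L1NJ (j : ℕ) (lam r : ℝ) (k₁ k₂ : ℝ → ℝ) (F₁ F₂ F₃ F₄ : ℝ → Fin 4 → ℝ)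
    (s t w : ℝ) : Fin 4 → ℝ :=
  (2 * (-(tau' j) * k₁ s * k₂ s * mu j lam 3 t w + deriv k₁ s * mu j lam 2 t w)
      / (r * (DJ j lam r k₁ s t w) ^ 3)) • F₁ s
  + (-2 * lam * (mu j lam 2 t w + 3 * r ^ 2 * (k₁ s) ^ 2 * (mu j lam 2 t w) ^ 3
      + k₁ s * (lam * r + 4 * sigma' j * r * (mu j lam 2 t w) ^ 2))
      / (r ^ 3 * (DJ j lam r k₁ s t w) ^ 2)) • F₂ s
  + (-2 * lam * sigma' j * mu j lam 3 t w * (1 + 3 * sigma' j * r * k₁ s * mu j lam 2 t w)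
      / (r ^ 3 * DJ j lam r k₁ s t w)) • F₃ s
  + (-2 * lam * mu j lam 4 t w * (sigma' j + 3 * r * k₁ s * mu j lam 2 t w)
      / (r ^ 3 * DJ j lam r k₁ s t w)) • F₄ s

/-- The operator `ℒ₂` applied to the Gauss map of `T^{j,λ}`. -/
def L2NJ (j : ℕ) (lam r : ℝ) (k₁ k₂ : ℝ → ℝ) (F₁ F₂ F₃ F₄ : ℝ → Fin 4 → ℝ)
    (s t w : ℝ) : Fin 4 → ℝ :=
  (lam ^ j * ((-1 : ℝ) ^ j * mu j lam 3 t w * k₁ s * k₂ s - sigma' j * mu j lam 2 t w * deriv k₁ s)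
      / (r ^ 2 * (DJ j lam r k₁ s t w) ^ 3)) • F₁ s
  + (-lam ^ (j + 1) * k₁ s * (2 * lam * sigma' j - 3 * (-1 : ℝ) ^ j * (mu j lam 4 t w) ^ 2
      - 3 * tau' j * (mu j lam 3 t w) ^ 2 - 3 * sigma' j * r * k₁ s * (mu j lam 2 t w) ^ 3)
      / (r ^ 3 * (DJ j lam r k₁ s t w) ^ 2)) • F₂ s
  + (3 * tau' j * lam ^ (j + 1) * r * k₁ s * mu j lam 2 t w * mu j lam 3 t w
      / (r ^ 4 * (tau' j + (-1 : ℝ) ^ j * r * k₁ s * mu j lam 2 t w))) • F₃ s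
  + (3 * tau' j * lam ^ (j + 1) * r * k₁ s * mu j lam 2 t w * mu j lam 4 t w
      / (r ^ 4 * (tau' j + (-1 : ℝ) ^ j * r * k₁ s * mu j lam 2 t w))) • F₄ s

theorem mink_add_left (u v w : Fin 4 → ℝ) : mink (u + v) w = mink u w + mink v w := by
  simp only [mink, Pi.add_apply]; ring

theorem mink_smul_left (a : ℝ) (u w : Fin 4 → ℝ) : mink (a • u) w = a * mink u w := by
  simp only [mink, Pi.smul_apply, smul_eq_mul]; ring

theorem mink_smul_right (a : ℝ) (u w : Fin 4 → ℝ) : mink u (a • w) = a * mink u w := by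
  simp only [mink, Pi.smul_apply, smul_eq_mul]; ring

theorem mink_comm (u v : Fin 4 → ℝ) : mink u v = mink v u := by
  simp only [mink]; ring

theorem HasDerivAt.mink_const_left {F : ℝ → Fin 4 → ℝ} {F' : Fin 4 → ℝ} {s : ℝ}
    (C : Fin 4 → ℝ) (h : HasDerivAt F F' s) :
    HasDerivAt (fun x => mink C (F x)) (mink C F') s := by
  have h' := hasDerivAt_pi.1 h
  exact ((((h' 0).const_mul (C 0)).neg.add ((h' 1).const_mul (C 1))).add
    ((h' 2).const_mul (C 2))).add ((h' 3).const_mul (C 3))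

/-- Components, with respect to an orthogonal frame, of an identity between vectors. -/
theorem mink_components {e₁ e₂ e₃ e₄ a₁ a₂ a₃ a₄ m n e x₂ x₃ x₄ : ℝ}
    {G₁ G₂ G₃ G₄ C : Fin 4 → ℝ}
    (h₁₁ : mink G₁ G₁ = e₁) (h₂₂ : mink G₂ G₂ = e₂) (h₃₃ : mink G₃ G₃ = e₃)
    (h₄₄ : mink G₄ G₄ = e₄) (h₁₂ : mink G₁ G₂ = 0) (h₁₃ : mink G₁ G₃ = 0)
    (h₁₄ : mink G₁ G₄ = 0) (h₂₃ : mink G₂ G₃ = 0) (h₂₄ : mink G₂ G₄ = 0)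
    (h₃₄ : mink G₃ G₄ = 0)
    (h : a₁ • G₁ + a₂ • G₂ + a₃ • G₃ + a₄ • G₄
      = m • (e • (x₂ • G₂ + x₃ • G₃ + x₄ • G₄)) + n • C) :
    a₁ * e₁ = n * mink C G₁ ∧ a₂ * e₂ = m * e * x₂ * e₂ + n * mink C G₂ ∧
      a₃ * e₃ = m * e * x₃ * e₃ + n * mink C G₃ ∧
      a₄ * e₄ = m * e * x₄ * e₄ + n * mink C G₄ := by
  have k (G : Fin 4 → ℝ) := congrArg (fun v => mink v G) h
  simp only [mink_add_left, mink_smul_left] at k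
  have k₁ := k G₁
  have k₂ := k G₂
  have k₃ := k G₃
  have k₄ := k G₄
  simp only [mink_comm G₂ G₁, mink_comm G₃ G₁, mink_comm G₄ G₁, mink_comm G₃ G₂,
    mink_comm G₄ G₂, mink_comm G₄ G₃, h₁₁, h₂₂, h₃₃, h₄₄, h₁₂, h₁₃, h₁₄, h₂₃, h₂₄, h₃₄]
    at k₁ k₂ k₃ k₄
  exact ⟨by linear_combination k₁, by linear_combination k₂, by linear_combination k₃,
    by linear_combination k₄⟩

theorem eq_zero_of_mul_add_eq_mul_of_ne {a b c K X X' : ℝ} (hc : c ≠ 0) (hX : X ≠ X')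
    (h : a * (c + b * X) = X * K) (h' : a * (c + b * X') = X' * K) : a = 0 := by
  have h₀ : a * (c * (X' - X)) = 0 := by linear_combination X' * h - X * h'
  simpa [hc, sub_ne_zero.2 hX.symm] using h₀

/-- If `μ₂` takes every real value, the regularity of the tube forces `k₁ = 0`. -/
theorem curvature_eq_zero_of_mu_surjective {j : ℕ} {lam r : ℝ} (hr : 0 < r) {k₁ : ℝ → ℝ}
    (hD : ∀ s t w : ℝ, DJ j lam r k₁ s t w ≠ 0)
    (hmu : ∀ a : ℝ, ∃ t w, mu j lam 2 t w = a) (s : ℝ) : k₁ s = 0 := by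
  by_contra hk
  obtain ⟨t, w, h⟩ := hmu (-sigma' j / (r * k₁ s))
  refine hD s t w ?_
  have := hr.ne'
  rw [DJ, h]
  field_simp
  ring

/-- Eliminating the two multipliers from the components along `F₁`, `F₂` and `F₄` at a point
where `μ₃` vanishes; here `X` and `Y` are the values of `μ₂` and `μ₄`. -/
theorem frame_coefficients_relation {r k k' δ X Y M n c₁ c₂ : ℝ} (hr : r ≠ 0) (hk : k ≠ 0)
    (hδ : δ ^ 2 = 1) (hD : δ + r * k * X ≠ 0) (hY : Y ≠ 0) (hn : n ≠ 0)
    (h₁ : -(δ * X * k') / (r ^ 2 * (δ + r * k * X) ^ 3) = n * c₁)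
    (h₂ : k * (δ - 3 * X ^ 2 * (δ + r * k * X)) / (r ^ 3 * (δ + r * k * X) ^ 2)
      = M * X - δ * (n * c₂))
    (h₄ : -3 * r * k * X * Y / (r ^ 4 * (δ + r * k * X)) = M * Y) :
    c₁ * k * (δ + r * k * X) = X * (δ * r * k' * c₂) ∧ c₂ ≠ 0 := by
  generalize δ + r * k * X = D at *
  have hM : M = -3 * k * X / (r ^ 3 * D) := by
    apply mul_right_cancel₀ hY
    rw [← h₄]
    field_simp
  have a₂ : n * c₂ = -k / (r ^ 3 * D ^ 2) := by
    have : n * c₂ = δ * (M * X - k * (δ - 3 * X ^ 2 * D) / (r ^ 3 * D ^ 2)) := by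
      rw [h₂]
      linear_combination -(n * c₂) * hδ
    rw [this, hM]
    field_simp
    linear_combination -hδ
  refine ⟨mul_left_cancel₀ hn ?_, ?_⟩
  · trans n * c₁ * (k * D)
    · ring
    trans n * c₂ * (X * (δ * r * k'))
    · rw [← h₁, a₂]
      field_simp
    · ring
  · rintro rfl
    rw [mul_zero] at a₂
    exact div_ne_zero (neg_ne_zero.2 hk) (by positivity) a₂.symm

theorem cosh_one_ne_cosh_two : cosh 1 ≠ cosh 2 :=
  (cosh_lt_cosh.2 (by norm_num [abs_of_pos])).ne

theorem no_generalized_L2_one_type_gauss_map_spacelike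
    (j : ℕ) (hj : j = 2 ∨ j = 3 ∨ j = 4) (lam : ℝ) (hlam : lam = 1 ∨ lam = -1)
    (r : ℝ) (hr : 0 < r)
    (β F₁ F₂ F₃ F₄ : ℝ → Fin 4 → ℝ) (k₁ k₂ k₃ : ℝ → ℝ)
    (hβ : ContDiff ℝ (⊤ : ℕ∞) β) (hF₁ : ContDiff ℝ (⊤ : ℕ∞) F₁) (hF₂ : ContDiff ℝ (⊤ : ℕ∞) F₂)
    (hF₃ : ContDiff ℝ (⊤ : ℕ∞) F₃) (hF₄ : ContDiff ℝ (⊤ : ℕ∞) F₄)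
    (hk₁ : ContDiff ℝ (⊤ : ℕ∞) k₁) (hk₂ : ContDiff ℝ (⊤ : ℕ∞) k₂) (hk₃ : ContDiff ℝ (⊤ : ℕ∞) k₃)
    (hβ' : ∀ s, deriv β s = F₁ s)
    (hF₁₁ : ∀ s, mink (F₁ s) (F₁ s) = eps j 1)
    (hF₂₂ : ∀ s, mink (F₂ s) (F₂ s) = eps j 2)
    (hF₃₃ : ∀ s, mink (F₃ s) (F₃ s) = eps j 3)
    (hF₄₄ : ∀ s, mink (F₄ s) (F₄ s) = eps j 4)
    (hF₁₂ : ∀ s, mink (F₁ s) (F₂ s) = 0)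
    (hF₁₃ : ∀ s, mink (F₁ s) (F₃ s) = 0)
    (hF₁₄ : ∀ s, mink (F₁ s) (F₄ s) = 0)
    (hF₂₃ : ∀ s, mink (F₂ s) (F₃ s) = 0)
    (hF₂₄ : ∀ s, mink (F₂ s) (F₄ s) = 0)
    (hF₃₄ : ∀ s, mink (F₃ s) (F₄ s) = 0)
    (hFr₁ : ∀ s, deriv F₁ s = k₁ s • F₂ s)
    (hFr₂ : ∀ s, deriv F₂ s = (-(eps j 1 * eps j 2) * k₁ s) • F₁ s + k₂ s • F₃ s)
    (hFr₃ : ∀ s, deriv F₃ s = (-(eps j 2 * eps j 3) * k₂ s) • F₂ s + k₃ s • F₄ s)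
    (hFr₄ : ∀ s, deriv F₄ s = (-(eps j 3 * eps j 4) * k₃ s) • F₃ s)
    (hD : ∀ s t w : ℝ, DJ j lam r k₁ s t w ≠ 0)
    (hD₂ : ∀ s t w : ℝ, tau' j + (-1 : ℝ) ^ j * r * k₁ s * mu j lam 2 t w ≠ 0)
    :
    ¬ ∃ (m n : ℝ × ℝ × ℝ → ℝ) (C : Fin 4 → ℝ),
      ContDiff ℝ (⊤ : ℕ∞) m ∧ ContDiff ℝ (⊤ : ℕ∞) n ∧ (∀ p, m p ≠ 0) ∧ (∀ p, n p ≠ 0) ∧ C ≠ 0 ∧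
        ∀ s t w : ℝ, L2NJ j lam r k₁ k₂ F₁ F₂ F₃ F₄ s t w
          = m (s, t, w) • gaussNJ j lam F₂ F₃ F₄ s t w + n (s, t, w) • C := by
  rintro ⟨m, n, C, -, -, hm, hn, -, H⟩
  have hr0 := hr.ne'
  have hlam0 : lam ≠ 0 := by rcases hlam with rfl | rfl <;> norm_num
  have hsig : sigma' j ≠ 0 := by unfold sigma'; split_ifs <;> norm_num
  have heps (i : ℕ) : eps j i ≠ 0 := by unfold eps; split_ifs <;> norm_num
  have E (s t w : ℝ) := mink_components (hF₁₁ s) (hF₂₂ s) (hF₃₃ s) (hF₄₄ s) (hF₁₂ s) (hF₁₃ s)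
    (hF₁₄ s) (hF₂₃ s) (hF₂₄ s) (hF₃₄ s) (H s t w)
  have hs1 : sinh 1 ≠ 0 := by simp
  have hs2 : sinh 2 ≠ 0 := by simp
  have hc1 : cosh 1 ≠ 0 := (cosh_pos 1).ne'
  have aux {e ε x x' c m m' n n' : ℝ} (he : e ≠ 0) (hε : ε ≠ 0) (hn : n ≠ 0) (hm : m' ≠ 0)
      (hx : x = 0) (hx' : x' ≠ 0) (h : 0 = m * e * x * ε + n * c)
      (h' : 0 = m' * e * x' * ε + n' * c) : False := by
    have hc : c = 0 := by simpa [hx, hn] using h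
    rw [hc, mul_zero, add_zero] at h'
    exact mul_ne_zero (mul_ne_zero (mul_ne_zero hm he) hx') hε h'.symm
  have hk (s : ℝ) : k₁ s ≠ 0 := by
    intro hk
    have hE : -sigma' j * lam ^ j ≠ 0 := mul_ne_zero (neg_ne_zero.2 hsig) (pow_ne_zero _ hlam0)
    have P := E s 0 1
    have Q := E s 1 1
    simp only [hk, mul_zero, zero_mul, zero_div] at P Q
    rcases hj with rfl | rfl | rfl
    · refine aux hE (heps 4) (hn _) (hm _) ?_ ?_ P.2.2.2 Q.2.2.2 <;>
        rcases hlam with rfl | rfl <;> norm_num [mu, hs1, hc1]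
    · refine aux hE (heps 2) (hn _) (hm _) ?_ ?_ P.2.1 Q.2.1 <;>
        rcases hlam with rfl | rfl <;> norm_num [mu, hs1, hc1]
    · refine aux hE (heps 3) (hn _) (hm _) ?_ ?_ P.2.2.1 Q.2.2.1 <;>
        rcases hlam with rfl | rfl <;> norm_num [mu, hs1, hc1]
  have hns : ¬ ∀ a : ℝ, ∃ t w, mu j lam 2 t w = a := fun h =>
    hk 0 (curvature_eq_zero_of_mu_surjective hr hD h 0)
  suffices hc : ∀ s, mink C (F₁ s) * k₁ s = 0 ∧ mink C (F₂ s) ≠ 0 by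
    have hc₁ (s : ℝ) : mink C (F₁ s) = 0 := (mul_eq_zero.1 (hc s).1).resolve_right (hk s)
    have hd := ((hF₁.differentiable (by simp)) 0).hasDerivAt.mink_const_left C
    rw [hFr₁, mink_smul_right, funext hc₁] at hd
    exact mul_ne_zero (hk 0) (hc 0).2 (hd.unique (hasDerivAt_const _ _))
  rcases hj with rfl | rfl | rfl <;> rcases hlam with rfl | rfl
  · exact absurd (fun a => ⟨0, arsinh a, by norm_num [mu]⟩) hns
  · intro s
    have m2 (t w : ℝ) : mu 2 (-1) 2 t w = cosh t * cosh w := by norm_num [mu]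
    have m3 (t w : ℝ) : mu 2 (-1) 3 t w = sinh w := by norm_num [mu]
    have m4 (t w : ℝ) : mu 2 (-1) 4 t w = sinh t * cosh w := by norm_num [mu]
    have σ2 : sigma' 2 = 1 := by norm_num [sigma']
    have τ2 : tau' 2 = 1 := by norm_num [tau']
    have ε1 : eps 2 1 = 1 := by norm_num [eps]
    have ε2 : eps 2 2 = -1 := by norm_num [eps]
    have ε4 : eps 2 4 = 1 := by norm_num [eps]
    simp only [m2, m3, m4, σ2, τ2, ε1, ε2, ε4, DJ] at E hD
    have h4 : mink C (F₄ s) = 0 := by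
      simpa [hn] using (E s 0 0).2.2.2
    have P (t : ℝ) (ht : sinh t ≠ 0) :
        mink C (F₁ s) * k₁ s * (1 + r * k₁ s * cosh t) = cosh t * (1 * r * deriv k₁ s * mink C (F₂ s))
        ∧ mink C (F₂ s) ≠ 0 := by
      obtain ⟨e₁, e₂, -, e₄⟩ := E s t 0
      have hd := hD s t 0
      rw [h4] at e₄
      simp only [cosh_zero, sinh_zero, mul_one] at e₁ e₂ e₄ hd
      refine frame_coefficients_relation (δ := 1) (M := -m (s, t, 0)) hr0 (hk s) (by norm_num)
        hd ht (hn (s, t, 0)) ?_ ?_ ?_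
      · linear_combination e₁
      · linear_combination -e₂ +
          3 * k₁ s / (r ^ 3 * (1 + r * k₁ s * cosh t) ^ 2) * sinh_sq t
      · convert e₄ using 2 <;> ring
    have P1 := P 1 hs1
    exact ⟨eq_zero_of_mul_add_eq_mul_of_ne one_ne_zero cosh_one_ne_cosh_two P1.1 (P 2 hs2).1,
      P1.2⟩
  · exact absurd (fun a => ⟨arsinh a, arsinh 1, by norm_num [mu]⟩) hns
  · exact absurd (fun a => ⟨arsinh a, 0, by norm_num [mu]⟩) hns
  · intro s
    have m2 (t w : ℝ) : mu 4 1 2 t w = cosh w := by norm_num [mu]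
    have m3 (t w : ℝ) : mu 4 1 3 t w = sinh t * sinh w := by norm_num [mu]
    have m4 (t w : ℝ) : mu 4 1 4 t w = cosh t * sinh w := by norm_num [mu]
    have σ4 : sigma' 4 = -1 := by norm_num [sigma']
    have τ4 : tau' 4 = -1 := by norm_num [tau']
    have ε1 : eps 4 1 = 1 := by norm_num [eps]
    have ε2 : eps 4 2 = 1 := by norm_num [eps]
    have ε4 : eps 4 4 = -1 := by norm_num [eps]
    simp only [m2, m3, m4, σ4, τ4, ε1, ε2, ε4, DJ] at E hD
    have h4 : mink C (F₄ s) = 0 := by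
      simpa [hn] using (E s 0 0).2.2.2
    have P (w : ℝ) (hw : sinh w ≠ 0) :
        mink C (F₁ s) * k₁ s * (-1 + r * k₁ s * cosh w)
          = cosh w * (-1 * r * deriv k₁ s * mink C (F₂ s)) ∧ mink C (F₂ s) ≠ 0 := by
      obtain ⟨e₁, e₂, -, e₄⟩ := E s 0 w
      have hd := hD s 0 w
      rw [h4] at e₄
      simp only [cosh_zero, sinh_zero, mul_one, one_mul, zero_mul] at e₁ e₂ e₄ hd
      refine frame_coefficients_relation (δ := -1) (M := m (s, 0, w)) hr0 (hk s) (by norm_num)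
        hd hw (hn (s, 0, w)) ?_ ?_ ?_
      · linear_combination e₁
      · linear_combination e₂ -
          3 * k₁ s / (r ^ 3 * (-1 + r * k₁ s * cosh w) ^ 2) * sinh_sq w
      · linear_combination -e₄
    have P1 := P 1 hs1
    exact ⟨eq_zero_of_mul_add_eq_mul_of_ne (by norm_num) cosh_one_ne_cosh_two P1.1 (P 2 hs2).1,
      P1.2⟩
  · exact absurd (fun a => ⟨0, arsinh a, by norm_num [mu]⟩) hns
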